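/- arXiv:2402.00511 — 2 statements merged into one kernel-verified Lean document; each statement's English description precedes it below -/
import Mathlib

section
/- Let X be a Banach two-sided ℍ-module, let D(A) be a right ℍ-submodule of X, and let A : D(A) → X be a closed right linear operator. Then for all p, q ∈ ρ_S(A): S_p⁻¹(A) − S_q⁻¹(A) = Q_q(A)[(p̄ − q̄)Id + (Δ_q(A) − Δ_p(A)) S_p⁻¹(A)]. -/
open MulOpposite Filter Topology Classical

noncomputable section

notation "ℍ" => Quaternion ℝ

/-- A *Banach two-sided `ℍ`-module*: a two-sided `ℍ`-module (left `ℍ`-action, right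
`ℍ`-action encoded as a left `ℍᵐᵒᵖ`-action) whose complete norm satisfies
`‖qx‖ = ‖xq‖ = |q|‖x‖`, and where real scalars act the same on both sides. -/
class QuatBimodule (Y : Type*) [NormedAddCommGroup Y]
    [Module ℍ Y] [Module ℍᵐᵒᵖ Y] : Prop where
  smul_op_comm : ∀ (p q : ℍ) (y : Y), p • (op q • y) = op q • (p • y)
  norm_smul_left : ∀ (q : ℍ) (y : Y), ‖q • y‖ = ‖q‖ * ‖y‖
  norm_smul_right : ∀ (q : ℍ) (y : Y), ‖op q • y‖ = ‖q‖ * ‖y‖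
  real_smul_comm : ∀ (r : ℝ) (y : Y), ((r : ℝ) : ℍ) • y = op ((r : ℝ) : ℍ) • y

variable {X : Type*} [NormedAddCommGroup X] [Module ℍ X] [Module ℍᵐᵒᵖ X]

/-- Membership in `Lin^r(X)`: additive, right `ℍ`-linear, with finite operator
norm (i.e. `‖B x‖` is bounded on the closed unit ball). -/
def MemLinR (B : X → X) : Prop :=
  (∀ x y : X, B (x + y) = B x + B y) ∧
  (∀ (q : ℍ) (x : X), B (op q • x) = op q • B x) ∧
  BddAbove ((fun x : X => ‖B x‖) '' {x : X | ‖x‖ ≤ 1})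

/-- The operator norm `‖B‖ = sup {‖B x‖ : ‖x‖ ≤ 1}`. -/
def opNorm (B : X → X) : ℝ :=
  sSup ((fun x : X => ‖B x‖) '' {x : X | ‖x‖ ≤ 1})

/-- A right linear operator `A : D(A) → X`, where `D(A)` is a right `ℍ`-submodule
of `X`.  It is encoded as a function `X → X` together with its domain; only the
values on the domain are relevant. -/
structure RightLinearOp (X : Type*) [NormedAddCommGroup X]
    [Module ℍ X] [Module ℍᵐᵒᵖ X] where
  dom : Set X
  toFun : X → X
  zero_mem : (0 : X) ∈ dom
  add_mem : ∀ ⦃x⦄, x ∈ dom → ∀ ⦃y⦄, y ∈ dom → x + y ∈ dom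
  neg_mem : ∀ ⦃x⦄, x ∈ dom → -x ∈ dom
  smulR_mem : ∀ (q : ℍ) ⦃x⦄, x ∈ dom → op q • x ∈ dom
  map_add' : ∀ ⦃x⦄, x ∈ dom → ∀ ⦃y⦄, y ∈ dom → toFun (x + y) = toFun x + toFun y
  map_smulR' : ∀ (q : ℍ) ⦃x⦄, x ∈ dom → toFun (op q • x) = op q • toFun x

namespace RightLinearOp

variable (T : RightLinearOp X)

/-- `A` is closed: its graph is closed in `X × X`. -/
def IsClosedOp : Prop := IsClosed {p : X × X | p.1 ∈ T.dom ∧ T.toFun p.1 = p.2}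

/-- The domain `D(A²)` of `A²`. -/
def dom2 : Set X := {x | x ∈ T.dom ∧ T.toFun x ∈ T.dom}

/-- The operator `Δ_q(A) = A² − 2 Re(q) A + |q|² Id`, with domain `D(A²)`. -/
def delta (q : ℍ) (x : X) : X :=
  T.toFun (T.toFun x) - ((2 * q.re : ℝ) : ℍ) • T.toFun x + ((‖q‖ ^ 2 : ℝ) : ℍ) • x

/-- `B` is the inverse of `Δ_q(A) : D(A²) → X`, and `B ∈ Lin^r(X)`. -/
def IsQInv (q : ℍ) (B : X → X) : Prop :=
  MemLinR B ∧ (∀ x : X, B x ∈ T.dom2) ∧ (∀ x : X, T.delta q (B x) = x) ∧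
    ∀ x ∈ T.dom2, B (T.delta q x) = x

/-- The S-resolvent set `ρ_S(A)`. -/
def rhoS : Set ℍ := {q | ∃ B : X → X, T.IsQInv q B}

/-- `Q_q(A) = Δ_q(A)⁻¹ ∈ Lin^r(X)`, for `q ∈ ρ_S(A)` (junk value otherwise). -/
def qres (q : ℍ) : X → X :=
  if h : q ∈ T.rhoS then h.choose else fun _ => 0

/-- The (left) S-resolvent operator `S_q⁻¹(A) = Q_q(A) q̄ − A Q_q(A)`, where the
right scalar multiple of an operator is `(B q̄)(x) = B(q̄ x)`. -/
def sres (q : ℍ) : X → X :=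
  fun x => T.qres q (star q • x) - T.toFun (T.qres q x)

/-- The coefficients `B_n`: `B_{2k} = Q_{q0}(A)^k`, `B_{2k+1} = Q_{q0}(A)^k S_{q0}⁻¹(A)`. -/
def Bop (q0 : ℍ) (n : ℕ) : X → X :=
  if n % 2 = 0 then (T.qres q0)^[n / 2] else (T.qres q0)^[n / 2] ∘ T.sres q0

end RightLinearOp

/-- The quaternionic polynomial `Δ_q(p) = p² − 2 Re(q) p + |q|²`. -/
def deltaPoly (q p : ℍ) : ℍ :=
  p ^ 2 - ((2 * q.re : ℝ) : ℍ) * p + ((‖q‖ ^ 2 : ℝ) : ℍ)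

/-- The "powers" `p_{q0,n}`: `p_{q0,2k}(q) = Δ_{q0}(q)^k`,
`p_{q0,2k+1}(q) = (q − q0) Δ_{q0}(q)^k`. -/
def spow (q0 : ℍ) (n : ℕ) (q : ℍ) : ℍ :=
  if n % 2 = 0 then deltaPoly q0 q ^ (n / 2) else (q - q0) * deltaPoly q0 q ^ (n / 2)

/-- The Cassini pseudo-metric `u(p,q) = √|Δ_q(p)|`. -/
def cassini (p q : ℍ) : ℝ := Real.sqrt ‖deltaPoly q p‖

/-- The Cassini ball `U(q0,R)`. -/
def cassiniBall (q0 : ℍ) (R : ℝ) : Set ℍ := {p : ℍ | cassini p q0 < R}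

/-- The Cassini topology on `ℍ`: the topology induced by the Cassini pseudo-metric,
i.e. the topology generated by the Cassini balls. -/
def cassiniTopology : TopologicalSpace ℍ :=
  TopologicalSpace.generateFrom {U : Set ℍ | ∃ q0 R, 0 < R ∧ U = cassiniBall q0 R}

/-- The spherical derivative of a function `g : ℍ → ℍ`. -/
def sderivQ (g : ℍ → ℍ) (q : ℍ) : ℍ :=
  if q.im = 0 then deriv (fun t : ℝ => g ((t : ℝ) : ℍ)) q.re
  else (g q - g (star q)) * (q - star q)⁻¹

end

namespace RightLinearOp

variable {X : Type*} [NormedAddCommGroup X] [Module ℍ X] [Module ℍᵐᵒᵖ X]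

theorem map_neg (T : RightLinearOp X) {x : X} (hx : x ∈ T.dom) :
    T.toFun (-x) = -T.toFun x := by
  simpa using T.map_smulR' (-1) hx

theorem sub_mem (T : RightLinearOp X) {x y : X} (hx : x ∈ T.dom) (hy : y ∈ T.dom) :
    x - y ∈ T.dom := by
  simpa [sub_eq_add_neg] using T.add_mem hx (T.neg_mem hy)

theorem map_sub (T : RightLinearOp X) {x y : X} (hx : x ∈ T.dom) (hy : y ∈ T.dom) :
    T.toFun (x - y) = T.toFun x - T.toFun y := by
  rw [sub_eq_add_neg, T.map_add' hx (T.neg_mem hy), T.map_neg hy, ← sub_eq_add_neg]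

theorem real_smul_mem [QuatBimodule X] (T : RightLinearOp X) (r : ℝ) {x : X} (hx : x ∈ T.dom) :
    (r : ℍ) • x ∈ T.dom := by
  rw [QuatBimodule.real_smul_comm]
  exact T.smulR_mem _ hx

theorem map_real_smul [QuatBimodule X] (T : RightLinearOp X) (r : ℝ) {x : X} (hx : x ∈ T.dom) :
    T.toFun ((r : ℍ) • x) = (r : ℍ) • T.toFun x := by
  rw [QuatBimodule.real_smul_comm, T.map_smulR' _ hx, ← QuatBimodule.real_smul_comm]

theorem isQInv_qres (T : RightLinearOp X) {q : ℍ} (hq : q ∈ T.rhoS) :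
    T.IsQInv q (T.qres q) := by
  rw [qres, dif_pos hq]
  exact hq.choose_spec

theorem delta_sub_delta (T : RightLinearOp X) (p q : ℍ) (x : X) :
    T.delta q x - T.delta p x =
      ((2 * (p.re - q.re) : ℝ) : ℍ) • T.toFun x + ((‖q‖ ^ 2 - ‖p‖ ^ 2 : ℝ) : ℍ) • x := by
  rw [mul_sub, Quaternion.coe_sub, Quaternion.coe_sub, sub_smul, sub_smul]
  unfold delta
  abel

namespace IsQInv

variable {T : RightLinearOp X} {q : ℍ} {B : X → X}

theorem map_add (h : T.IsQInv q B) (x y : X) : B (x + y) = B x + B y :=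
  h.1.1 x y

theorem map_sub (h : T.IsQInv q B) (x y : X) : B (x - y) = B x - B y :=
  _root_.map_sub (AddMonoidHom.mk' B h.1.1) x y

/-- The inverse of `Δ_q(A)` commutes with `A` on the domain of `A`. -/
theorem apply_toFun [QuatBimodule X] (h : T.IsQInv q B) {y : X} (hy : y ∈ T.dom) :
    B (T.toFun y) = T.toFun (B y) := by
  obtain ⟨hw, hAw⟩ := h.2.1 y
  have hre := T.real_smul_mem (2 * q.re) hAw
  have hnorm := T.real_smul_mem (‖q‖ ^ 2) hw
  have hΔ := h.2.2.1 y
  unfold delta at hΔ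
  have hsq : T.toFun (T.toFun (B y)) =
      y + ((2 * q.re : ℝ) : ℍ) • T.toFun (B y) - ((‖q‖ ^ 2 : ℝ) : ℍ) • B y := by
    nth_rewrite 2 [← hΔ]
    abel
  have hsq_mem : T.toFun (T.toFun (B y)) ∈ T.dom := by
    rw [hsq]
    exact T.sub_mem (T.add_mem hy hre) hnorm
  have hcomm : T.delta q (T.toFun (B y)) = T.toFun y := by
    rw [← hΔ, T.map_add' (T.sub_mem hsq_mem hre) hnorm, T.map_sub hsq_mem hre,
      T.map_real_smul _ hAw, T.map_real_smul _ hw, hΔ, delta]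
  rw [← hcomm, h.2.2.2 _ ⟨hAw, hsq_mem⟩]

end IsQInv

end RightLinearOp

/-- Lemma `L:Cq-Cp-step1`: for all `p, q ∈ ρ_S(A)`,
`S_p⁻¹(A) − S_q⁻¹(A) = Q_q(A)[(p̄ − q̄) Id + (Δ_q(A) − Δ_p(A)) S_p⁻¹(A)]`,
where `Δ_q(A) − Δ_p(A) = 2 Re(p − q) A + (|q|² − |p|²) Id` and quaternionic
scalars act on the left inside operators. -/
theorem stmt9 {X : Type*} [NormedAddCommGroup X] [CompleteSpace X]
    [Module ℍ X] [Module ℍᵐᵒᵖ X] [QuatBimodule X]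
    (T : RightLinearOp X) (hT : T.IsClosedOp) :
    ∀ p ∈ T.rhoS, ∀ q ∈ T.rhoS, ∀ x : X,
      T.sres p x - T.sres q x =
        T.qres q ((star p - star q) • x +
          ((2 * (p.re - q.re) : ℝ) : ℍ) • T.toFun (T.sres p x) +
          ((‖q‖ ^ 2 - ‖p‖ ^ 2 : ℝ) : ℍ) • T.sres p x) := by
  intro p hp q hq x
  have hP := T.isQInv_qres hp
  have hQ := T.isQInv_qres hq
  unfold RightLinearOp.sres
  set u := T.qres p (star p • x)
  set v := T.qres p x
  have hu2 : u ∈ T.dom2 := hP.2.1 _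
  have hv2 : v ∈ T.dom2 := hP.2.1 _
  have hΔu := T.delta_sub_delta p q u
  have hΔv := T.delta_sub_delta p q v
  rw [hP.2.2.1] at hΔu hΔv
  set c : ℝ := 2 * (p.re - q.re)
  set d : ℝ := ‖q‖ ^ 2 - ‖p‖ ^ 2
  have hcv := T.real_smul_mem c hv2.2
  have hdv := T.real_smul_mem d hv2.1
  have hQu : T.qres q ((c : ℍ) • T.toFun u + (d : ℍ) • u) = u - T.qres q (star p • x) := by
    rw [← hΔu, hQ.map_sub, hQ.2.2.2 _ hu2]
  have hQv : T.qres q ((c : ℍ) • T.toFun (T.toFun v) + (d : ℍ) • T.toFun v) =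
      T.toFun v - T.toFun (T.qres q x) := by
    rw [← T.map_real_smul c hv2.2, ← T.map_real_smul d hv2.1, ← T.map_add' hcv hdv,
      hQ.apply_toFun (T.add_mem hcv hdv), ← hΔv, hQ.map_sub, hQ.2.2.2 _ hv2,
      T.map_sub hv2.1 (hQ.2.1 x).1]
  have hsplit : (star p - star q) • x + (c : ℍ) • T.toFun (u - T.toFun v) +
      (d : ℍ) • (u - T.toFun v) =
      star p • x - star q • x + ((c : ℍ) • T.toFun u + (d : ℍ) • u) -
        ((c : ℍ) • T.toFun (T.toFun v) + (d : ℍ) • T.toFun v) := by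
    rw [T.map_sub hu2.1 hv2.2, smul_sub, smul_sub, sub_smul]
    abel
  rw [hsplit, hQ.map_sub, hQ.map_add, hQ.map_sub, hQu, hQv]
  abel
end

section
/- Let D be a nonempty open subset of ℂ invariant under complex conjugation and let f : Ω_D → X be a right slice regular function. Then the spherical derivative ∂_S f : Ω_D → X is a real analytic function (Ω_D being regarded as an open subset of ℝ⁴ and X as a real Banach space). -/
open MulOpposite Filter Topology Classical

noncomputable section

/-- The unit imaginary sphere `S = {j ∈ ℍ : j² = −1}`. -/
def Sph : Set ℍ := {j : ℍ | j * j = -1}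

/-- The circularization `Ω_D ⊆ ℍ` of a set `D ⊆ ℂ`. -/
def circ (D : Set ℂ) : Set ℍ :=
  {q : ℍ | ∃ (r s : ℝ) (j : ℍ), j ∈ Sph ∧ (⟨r, s⟩ : ℂ) ∈ D ∧ q = ((r : ℝ) : ℍ) + s • j}

/-- A function `f : Ω_D → X`, `X` a Banach two-sided `ℍ`-module, is
*right slice regular* if it is induced by a stem function `F = (F₁,F₂) : D → X²`
(`F₁` even, `F₂` odd under complex conjugation) of class `C¹` in the real sense,
i.e. `f(r + s j) = F₁(r + s i) + F₂(r + s i) j` for all `j ∈ S`, satisfying the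
Cauchy–Riemann equations `∂F₁/∂r = ∂F₂/∂s`, `∂F₁/∂s = −∂F₂/∂r` on `D`. -/
def RightSliceRegular {X : Type*} [NormedAddCommGroup X] [Module ℍ X]
    [Module ℍᵐᵒᵖ X] [NormedSpace ℝ X] (D : Set ℂ) (f : ℍ → X) : Prop :=
  ∃ F₁ F₂ : ℂ → X,
    (∀ z ∈ D, F₁ ((starRingEnd ℂ) z) = F₁ z) ∧
    (∀ z ∈ D, F₂ ((starRingEnd ℂ) z) = -F₂ z) ∧
    ContDiffOn ℝ 1 F₁ D ∧ ContDiffOn ℝ 1 F₂ D ∧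
    (∀ r s : ℝ, (⟨r, s⟩ : ℂ) ∈ D → ∀ j ∈ Sph,
      f (((r : ℝ) : ℍ) + s • j) = F₁ ⟨r, s⟩ + op j • F₂ ⟨r, s⟩) ∧
    (∀ z ∈ D, fderiv ℝ F₁ z 1 = fderiv ℝ F₂ z Complex.I ∧
      fderiv ℝ F₁ z Complex.I = -fderiv ℝ F₂ z 1)

/-- The spherical derivative of an `X`-valued function on `ℍ`:
`∂_S f(q) = (f(q) − f(q̄))(q − q̄)⁻¹` off the real axis, and the derivative of `f`
along the real axis at real points. -/
def sderivX {X : Type*} [NormedAddCommGroup X] [Module ℍ X] [Module ℍᵐᵒᵖ X]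
    [NormedSpace ℝ X] (f : ℍ → X) (q : ℍ) : X :=
  if q.im = 0 then deriv (fun t : ℝ => f ((t : ℝ) : ℍ)) q.re
  else op ((q - star q)⁻¹) • (f q - f (star q))

/-- `g : Ω → Z`, with `Ω ⊆ ℍ ≅ ℝ⁴` and `Z` a real Banach space, is real
analytic: around every point of `Ω` it is the sum, in the sense of summability,
of a power series in the four real coordinates with coefficients in `Z`. -/
def RealAnalyticOnH {Z : Type*} [NormedAddCommGroup Z] [NormedSpace ℝ Z]
    (g : ℍ → Z) (Ω : Set ℍ) : Prop :=
  ∀ q0 ∈ Ω, ∃ ε : ℝ, 0 < ε ∧ Metric.ball q0 ε ⊆ Ω ∧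
    ∃ c : (Fin 4 → ℕ) → Z, ∀ q ∈ Metric.ball q0 ε,
      HasSum (fun h : Fin 4 → ℕ =>
        (((q.re - q0.re) ^ h 0 * (q.imI - q0.imI) ^ h 1 *
          (q.imJ - q0.imJ) ^ h 2 * (q.imK - q0.imK) ^ h 3 : ℝ)) • c h) (g q)

end

section MultiIndex

variable {Z : Type*} [NormedAddCommGroup Z] [NormedSpace ℝ Z]

/-- The standard basis `1, i, j, k` of the quaternions. -/
def quatUnit : Fin 4 → ℍ := ![⟨1, 0, 0, 0⟩, ⟨0, 1, 0, 0⟩, ⟨0, 0, 1, 0⟩, ⟨0, 0, 0, 1⟩]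

/-- The four real coordinates of a quaternion. -/
def quatCoord (q : ℍ) : Fin 4 → ℝ := ![q.re, q.imI, q.imJ, q.imK]

theorem sum_quatCoord_smul_quatUnit (q : ℍ) : ∑ i, quatCoord q i • quatUnit i = q := by
  rw [Fin.sum_univ_four]
  ext <;> simp only [Quaternion.re_add, Quaternion.imI_add, Quaternion.imJ_add,
    Quaternion.imK_add, Quaternion.re_smul, Quaternion.imI_smul, Quaternion.imJ_smul,
    Quaternion.imK_smul] <;> simp [quatUnit, quatCoord]

theorem norm_quatUnit_le (i : Fin 4) : ‖quatUnit i‖ ≤ 1 := by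
  rw [← abs_of_nonneg (norm_nonneg (quatUnit i)), ← sq_le_one_iff_abs_le_one, pow_two,
    ← Quaternion.normSq_eq_norm_mul_self, Quaternion.normSq_def']
  fin_cases i <;> simp [quatUnit]

theorem norm_quatCoord_le (q : ℍ) (i : Fin 4) : ‖quatCoord q i‖ ≤ ‖q‖ := by
  rw [Real.norm_eq_abs]
  refine abs_le_of_sq_le_sq ?_ (norm_nonneg q)
  rw [pow_two ‖q‖, ← Quaternion.normSq_eq_norm_mul_self, Quaternion.normSq_def']
  fin_cases i <;> simp [quatCoord] <;> nlinarith [sq_nonneg q.re, sq_nonneg q.imI,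
    sq_nonneg q.imJ, sq_nonneg q.imK]

/-- The multi-index counting how often each coordinate direction occurs in a word. -/
def wordCount (w : Σ n : ℕ, Fin n → Fin 4) (i : Fin 4) : ℕ :=
  (Finset.univ.filter fun k => w.2 k = i).card

theorem prod_word_eq (v : Fin 4 → ℝ) (w : Σ n : ℕ, Fin n → Fin 4) :
    ∏ k, v (w.2 k) = ∏ i, v i ^ wordCount w i := by
  rw [← Finset.prod_fiberwise Finset.univ w.2]
  refine Finset.prod_congr rfl fun i _ => ?_
  rw [wordCount, Finset.prod_congr rfl (g := fun _ => v i), Finset.prod_const]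
  intro k hk
  rw [(Finset.mem_filter.mp hk).2]

theorem FormalMultilinearSeries.hasSum_words [CompleteSpace Z]
    (p : FormalMultilinearSeries ℝ ℍ Z) {r : NNReal} (hr : (r : ENNReal) < p.radius)
    {y : ℍ} (hy : 4 * ‖y‖ ≤ r) {a : Z} (ha : HasSum (fun n => p n fun _ => y) a) :
    HasSum (fun w : Σ n : ℕ, Fin n → Fin 4 =>
      (∏ k, quatCoord y (w.2 k)) • p w.1 fun k => quatUnit (w.2 k)) a := by
  refine HasSum.sigma_of_hasSum ha (fun n => ?_) ?_
  · have h : (p n fun _ => y) = ∑ s : Fin n → Fin 4,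
        (∏ k, quatCoord y (s k)) • p n fun k => quatUnit (s k) := by
      conv_lhs => rw [← sum_quatCoord_smul_quatUnit y]
      rw [ContinuousMultilinearMap.map_sum]
      exact Finset.sum_congr rfl fun s _ => (p n).map_smul_univ _ _
    rw [h]
    exact hasSum_fintype _
  · refine Summable.of_norm_bounded (g := fun w : Σ n : ℕ, Fin n → Fin 4 =>
      ‖y‖ ^ w.1 * ‖p w.1‖) ?_ fun w => ?_
    · refine (summable_sigma_of_nonneg fun w => by positivity).2
        ⟨fun n => Summable.of_finite, ?_⟩
      refine Summable.of_nonneg_of_le (fun n => tsum_nonneg fun _ => by positivity)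
        (fun n => ?_) (p.summable_norm_mul_pow hr)
      change ∑' _ : Fin n → Fin 4, ‖y‖ ^ n * ‖p n‖ ≤ _
      rw [tsum_fintype, Finset.sum_const, Finset.card_univ, Fintype.card_fun,
        Fintype.card_fin, Fintype.card_fin, nsmul_eq_mul, ← mul_assoc, mul_comm]
      push_cast
      rw [← mul_pow]
      gcongr
    · rw [norm_smul, norm_prod]
      gcongr
      · refine (Finset.prod_le_prod (fun _ _ => norm_nonneg _)
          fun k _ => norm_quatCoord_le y (w.2 k)).trans ?_
        simp
      · refine ((p w.1).le_opNorm _).trans (mul_le_of_le_one_right (norm_nonneg _) ?_)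
        exact Finset.prod_le_one (fun _ _ => norm_nonneg _) fun k _ => norm_quatUnit_le (w.2 k)

theorem realAnalyticOnH_of_analyticAt [CompleteSpace Z] {g : ℍ → Z} {Ω : Set ℍ}
    (hΩ : IsOpen Ω) (hg : ∀ q ∈ Ω, AnalyticAt ℝ g q) : RealAnalyticOnH g Ω := by
  intro q0 hq0
  obtain ⟨p, R, hp⟩ := hg q0 hq0
  obtain ⟨δ, hδ, hball⟩ := Metric.isOpen_iff.1 hΩ q0 hq0
  obtain ⟨r, hr0, hrR⟩ := ENNReal.lt_iff_exists_nnreal_btwn.1 hp.r_pos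
  have hr0' : (0 : ℝ) < r := by exact_mod_cast hr0
  refine ⟨min δ (r / 4), by positivity,
    (Metric.ball_subset_ball (min_le_left _ _)).trans hball,
    fun h => ∑' w : wordCount ⁻¹' {h}, p w.1.1 fun k => quatUnit (w.1.2 k), fun q hq => ?_⟩
  have hq' : ‖q - q0‖ < r / 4 := by
    rw [← dist_eq_norm]
    exact (Metric.mem_ball.1 hq).trans_le (min_le_right _ _)
  have hs : HasSum (fun n => p n fun _ => q - q0) (g q) := by
    refine hp.hasSum_sub ?_
    rw [Metric.mem_eball, edist_dist, dist_eq_norm]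
    refine lt_trans ?_ hrR
    rw [← ENNReal.ofReal_coe_nnreal, ENNReal.ofReal_lt_ofReal_iff hr0']
    linarith
  convert (p.hasSum_words (hrR.trans_le hp.r_le) (by linarith) hs).tsum_fiberwise
    wordCount using 2 with h
  rw [← tsum_const_smul'']
  refine tsum_congr fun w => ?_
  have hw : wordCount w.1 = h := w.2
  rw [prod_word_eq, hw, Fin.prod_univ_four]
  simp [quatCoord]

end MultiIndex

section ComplexStem

theorem stem_odd_part_eq {E : Type*} [AddCommGroup E] [Module ℂ E] {D : Set ℂ}
    {F₁ F₂ : ℂ → E} (hev : ∀ z ∈ D, F₁ ((starRingEnd ℂ) z) = F₁ z)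
    (hodd : ∀ z ∈ D, F₂ ((starRingEnd ℂ) z) = -F₂ z) {z : ℂ} (hz : z ∈ D) :
    F₂ z = (2 * Complex.I)⁻¹ • ((F₁ z + Complex.I • F₂ z) -
      (F₁ ((starRingEnd ℂ) z) + Complex.I • F₂ ((starRingEnd ℂ) z))) := by
  rw [hev z hz, hodd z hz, eq_inv_smul_iff₀ (by simp), mul_smul, two_smul, smul_neg]
  abel

variable {E : Type*} [NormedAddCommGroup E] [NormedSpace ℝ E] [NormedSpace ℂ E]
  [IsScalarTower ℝ ℂ E] {D : Set ℂ} {F₁ F₂ : ℂ → E}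

theorem differentiableOn_stem (hopen : IsOpen D)
    (h₁ : ContDiffOn ℝ 1 F₁ D) (h₂ : ContDiffOn ℝ 1 F₂ D)
    (hCR : ∀ z ∈ D, fderiv ℝ F₁ z 1 = fderiv ℝ F₂ z Complex.I ∧
      fderiv ℝ F₁ z Complex.I = -fderiv ℝ F₂ z 1) :
    DifferentiableOn ℂ (fun z => F₁ z + Complex.I • F₂ z) D := by
  intro z hz
  have d₁ : DifferentiableAt ℝ F₁ z :=
    (h₁.differentiableOn one_ne_zero).differentiableAt (hopen.mem_nhds hz)
  have d₂ : DifferentiableAt ℝ F₂ z :=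
    (h₂.differentiableOn one_ne_zero).differentiableAt (hopen.mem_nhds hz)
  have hd := d₁.hasFDerivAt.add (d₂.hasFDerivAt.const_smul Complex.I)
  refine DifferentiableAt.differentiableWithinAt ?_
  refine (differentiableAt_iff_restrictScalars ℝ hd.differentiableAt).2
    ⟨ContinuousLinearMap.toSpanSingleton ℂ
      (fderiv ℝ F₁ z 1 + Complex.I • fderiv ℝ F₂ z 1), ?_⟩
  refine Eq.trans ?_ hd.fderiv.symm
  ext w
  have hw : w = w.re • (1 : ℂ) + w.im • Complex.I := by
    apply Complex.ext <;> simp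
  obtain ⟨c₁, c₂⟩ := hCR z hz
  have hI : Complex.I • Complex.I • fderiv ℝ F₂ z 1 = -fderiv ℝ F₂ z 1 := by
    rw [smul_smul, Complex.I_mul_I, neg_one_smul]
  suffices h : w • (fderiv ℝ F₁ z 1 + Complex.I • fderiv ℝ F₂ z 1) =
      fderiv ℝ F₁ z w + Complex.I • fderiv ℝ F₂ z w by simpa using h
  rw [hw]
  simp only [map_add, map_smul, add_smul, smul_add, smul_assoc, one_smul, hI, c₂, ← c₁]
  simp only [smul_comm Complex.I (_ : ℝ), smul_neg]
  abel

variable [CompleteSpace E]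

theorem analyticAt_stem_odd_part (hopen : IsOpen D) (hconj : ∀ z ∈ D, (starRingEnd ℂ) z ∈ D)
    (hev : ∀ z ∈ D, F₁ ((starRingEnd ℂ) z) = F₁ z)
    (hodd : ∀ z ∈ D, F₂ ((starRingEnd ℂ) z) = -F₂ z)
    (hd : DifferentiableOn ℂ (fun z => F₁ z + Complex.I • F₂ z) D) {z : ℂ} (hz : z ∈ D) :
    AnalyticAt ℝ F₂ z := by
  have hg : ∀ w ∈ D, AnalyticAt ℝ (fun z => F₁ z + Complex.I • F₂ z) w := fun w hw =>
    (hd.analyticAt (hopen.mem_nhds hw)).restrictScalars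
  have hc : AnalyticAt ℝ (fun z => F₁ ((starRingEnd ℂ) z) +
      Complex.I • F₂ ((starRingEnd ℂ) z)) z :=
    AnalyticAt.comp (g := fun z => F₁ z + Complex.I • F₂ z) (hg _ (hconj z hz))
      (Complex.conjCLE.toContinuousLinearMap.analyticAt z)
  have hs := (((2 * Complex.I)⁻¹ • ContinuousLinearMap.id ℝ E).analyticAt _).comp
    ((hg z hz).sub hc)
  refine hs.congr ?_
  filter_upwards [hopen.mem_nhds hz] with w hw
  simpa using (stem_odd_part_eq hev hodd hw).symm

theorem hasSum_stem_odd_part (hopen : IsOpen D)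
    (hev : ∀ z ∈ D, F₁ ((starRingEnd ℂ) z) = F₁ z)
    (hodd : ∀ z ∈ D, F₂ ((starRingEnd ℂ) z) = -F₂ z)
    (hd : DifferentiableOn ℂ (fun z => F₁ z + Complex.I • F₂ z) D) {t : ℝ} (ht : (t : ℂ) ∈ D) :
    ∃ (a : ℕ → E) (ρ : ℝ) (C : ℝ), 0 < ρ ∧ (∀ n, ‖a n‖ * ρ ^ n ≤ C) ∧
      ∀ z : ℂ, ‖z - t‖ < ρ → HasSum (fun n => ((z - t) ^ n).im • a n) (F₂ z) := by
  obtain ⟨p, R, hp⟩ := hd.analyticAt (hopen.mem_nhds ht)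
  obtain ⟨δ, hδ, hball⟩ := Metric.isOpen_iff.1 hopen t ht
  obtain ⟨r, hr0, hrR⟩ := ENNReal.lt_iff_exists_nnreal_btwn.1
    (lt_min hp.r_pos (ENNReal.ofReal_pos.2 hδ))
  have hr0' : (0 : ℝ) < r := by exact_mod_cast hr0
  obtain ⟨C, -, hC⟩ :=
    p.norm_mul_pow_le_of_lt_radius ((hrR.trans_le (min_le_left _ _)).trans_le hp.r_le)
  refine ⟨p.coeff, r, C, hr0', fun n => by simpa using hC n, fun z hz => ?_⟩
  have hsum : ∀ w : ℂ, ‖w - t‖ < r →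
      HasSum (fun n => (w - t) ^ n • p.coeff n) (F₁ w + Complex.I • F₂ w) := by
    intro w hw
    simpa using hp.hasSum_sub (y := w) (by
      rw [Metric.mem_eball, edist_dist, dist_eq_norm]
      refine lt_trans ?_ (hrR.trans_le (min_le_left _ _))
      rwa [← ENNReal.ofReal_coe_nnreal, ENNReal.ofReal_lt_ofReal_iff hr0'])
  have hzD : z ∈ D := by
    refine hball ?_
    rw [Metric.mem_ball, dist_eq_norm]
    refine hz.trans ?_
    have := hrR.trans_le (min_le_right _ _)
    rwa [← ENNReal.ofReal_coe_nnreal, ENNReal.ofReal_lt_ofReal_iff hδ] at this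
  have hcz : (starRingEnd ℂ) z - t = (starRingEnd ℂ) (z - t) := by simp
  have h := ((hsum z hz).sub (hsum ((starRingEnd ℂ) z)
    (by rwa [hcz, Complex.norm_conj]))).const_smul (2 * Complex.I)⁻¹
  rw [← stem_odd_part_eq hev hodd hzD] at h
  convert h using 2 with n
  rw [hcz, ← map_pow, ← sub_smul, smul_smul, ← algebraMap_smul ℂ ((z - t) ^ n).im,
    Complex.sub_conj]
  congr 1
  rw [eq_inv_mul_iff_mul_eq₀ (by simp)]
  simp
  ring

end ComplexStem

section Circularization

theorem Sph.re_eq_zero {j : ℍ} (hj : j ∈ Sph) : j.re = 0 ∧ ‖j‖ = 1 := by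
  have hj' : j * j = -1 := hj
  have hn : ‖j‖ * ‖j‖ = 1 := by rw [← norm_mul, hj', norm_neg, norm_one]
  have h1 : ‖j‖ = 1 := by nlinarith [norm_nonneg j]
  refine ⟨?_, h1⟩
  rw [← Quaternion.normSq_eq_norm_mul_self, Quaternion.normSq_def'] at hn
  have hr := congrArg (fun q : ℍ => q.re) hj'
  simp only [Quaternion.re_mul, Quaternion.re_neg, Quaternion.re_one] at hr
  nlinarith

theorem Sph.I_mem : ((Complex.I : ℂ) : ℍ) ∈ Sph := by
  change ((Complex.I : ℂ) : ℍ) * ((Complex.I : ℂ) : ℍ) = -1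
  rw [← Quaternion.coeComplex_mul, Complex.I_mul_I,
    ← Quaternion.coe_ofComplex, map_neg, map_one]

theorem exists_eq_re_add_norm_im_smul (q : ℍ) :
    ∃ j ∈ Sph, q = ((q.re : ℝ) : ℍ) + ‖q.im‖ • j := by
  by_cases h : q.im = 0
  · refine ⟨_, Sph.I_mem, ?_⟩
    rw [h, norm_zero, zero_smul, add_zero]
    conv_lhs => rw [← Quaternion.re_add_im q, h, add_zero]
  · have hn : ‖q.im‖ ≠ 0 := norm_ne_zero_iff.2 h
    refine ⟨‖q.im‖⁻¹ • q.im, ?_, ?_⟩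
    · change (‖q.im‖⁻¹ • q.im) * (‖q.im‖⁻¹ • q.im) = -1
      rw [smul_mul_smul_comm, ← pow_two q.im, Quaternion.im_sq,
        Quaternion.normSq_eq_norm_mul_self]
      rw [smul_neg, ← Quaternion.coe_smul, smul_eq_mul]
      rw [show ‖q.im‖⁻¹ * ‖q.im‖⁻¹ * (‖q.im‖ * ‖q.im‖) = 1 by field_simp]
      simp
    · rw [smul_smul, mul_inv_cancel₀ hn, one_smul, Quaternion.re_add_im]

theorem mem_circ_iff {D : Set ℂ} (hconj : ∀ z ∈ D, (starRingEnd ℂ) z ∈ D) (q : ℍ) :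
    q ∈ circ D ↔ (⟨q.re, ‖q.im‖⟩ : ℂ) ∈ D := by
  constructor
  · rintro ⟨r, s, j, hj, hD, rfl⟩
    obtain ⟨hre, hn⟩ := Sph.re_eq_zero hj
    have him : j.im = j := by
      conv_rhs => rw [← Quaternion.re_add_im j, hre]
      simp
    have h1 : (((r : ℝ) : ℍ) + s • j).re = r := by simp [hre]
    have h2 : ‖(((r : ℝ) : ℍ) + s • j).im‖ = |s| := by
      simp [him, norm_smul, hn]
    rw [h1, h2]
    rcases abs_choice s with h | h <;> rw [h]
    · exact hD
    · exact hconj _ hD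
  · intro h
    obtain ⟨j, hj, hq⟩ := exists_eq_re_add_norm_im_smul q
    exact ⟨_, _, j, hj, h, hq⟩

theorem continuous_re_norm_im : Continuous fun q : ℍ => (⟨q.re, ‖q.im‖⟩ : ℂ) :=
  Complex.equivRealProdCLM.symm.continuous.comp
    (Quaternion.continuous_re.prodMk Quaternion.continuous_im.norm)

theorem isOpen_circ {D : Set ℂ} (hopen : IsOpen D)
    (hconj : ∀ z ∈ D, (starRingEnd ℂ) z ∈ D) : IsOpen (circ D) := by
  have : circ D = (fun q : ℍ => (⟨q.re, ‖q.im‖⟩ : ℂ)) ⁻¹' D := by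
    ext q
    exact mem_circ_iff hconj q
  rw [this]
  exact hopen.preimage continuous_re_norm_im

end Circularization

noncomputable section QuaternionPolynomials

/-- Every `j ∈ S` gives a copy of `ℂ` inside `ℍ`. -/
def sliceHom (j : Sph) : ℂ →ₐ[ℝ] ℍ := Complex.lift ⟨j.1, j.2⟩

theorem sliceHom_apply (j : Sph) (z : ℂ) : sliceHom j z = ((z.re : ℝ) : ℍ) + z.im • j.1 :=
  rfl

theorem star_sliceHom (j : Sph) (z : ℂ) :
    star (sliceHom j z) = sliceHom j ((starRingEnd ℂ) z) := by
  have hj : star j.1 = -j.1 := Quaternion.star_eq_neg.2 (Sph.re_eq_zero j.2).1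
  simp [sliceHom_apply, hj]

/-- The real-valued polynomial `(qⁿ⁺¹ - q̄ⁿ⁺¹) / (q - q̄)`. -/
def sphericalPower (n : ℕ) (q : ℍ) : ℍ := ∑ k ∈ Finset.range (n + 1), q ^ k * star q ^ (n - k)

theorem sphericalPower_sliceHom (n : ℕ) (j : Sph) {w : ℂ} (hw : w.im ≠ 0) :
    sphericalPower n (sliceHom j w) = (((w ^ (n + 1)).im / w.im : ℝ) : ℍ) := by
  have hc : ∑ k ∈ Finset.range (n + 1), w ^ k * (starRingEnd ℂ) w ^ (n - k) =
      (((w ^ (n + 1)).im / w.im : ℝ) : ℂ) := by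
    have hne : w - (starRingEnd ℂ) w ≠ 0 := by
      rw [Complex.sub_conj]
      simp [hw]
    refine mul_right_cancel₀ hne ?_
    have h := (Commute.all w ((starRingEnd ℂ) w)).geom_sum₂_mul (n + 1)
    simp only [Nat.add_sub_cancel] at h
    have hw' : (w.im : ℂ) ≠ 0 := by exact_mod_cast hw
    rw [h, ← map_pow, Complex.sub_conj, Complex.sub_conj]
    push_cast
    field_simp
  rw [sphericalPower, star_sliceHom]
  simp only [← map_pow, ← map_mul, ← map_sum]
  simp only [map_pow]
  rw [hc]
  exact (sliceHom j).commutes _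

theorem norm_coeComplex (z : ℂ) : ‖(z : ℍ)‖ = ‖z‖ := by
  refine (sq_eq_sq₀ (norm_nonneg _) (norm_nonneg _)).1 ?_
  rw [pow_two ‖(z : ℍ)‖, ← Quaternion.normSq_eq_norm_mul_self, Quaternion.normSq_def',
    Complex.sq_norm, Complex.normSq_apply]
  simp
  ring

/-- Quaternionic conjugation as a continuous real-linear map. -/
def quatConjCLM : ℍ →L[ℝ] ℍ :=
  LinearMap.mkContinuous
    { toFun := star
      map_add' := star_add
      map_smul' := fun r q => Quaternion.star_smul r q } 1 fun q => by simp

theorem quatConjCLM_apply (q : ℍ) : quatConjCLM q = star q := rfl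

end QuaternionPolynomials

noncomputable section BimoduleStructure

variable {X : Type*} [NormedAddCommGroup X] [Module ℍ X] [Module ℍᵐᵒᵖ X] [QuatBimodule X]

variable (X) in
/-- `X` as a complex normed space, `z = r + s i` acting by right multiplication by the
quaternion `r + s i`. -/
abbrev rightComplexSpace : NormedSpace ℂ X where
  smul z x := op (z : ℍ) • x
  one_smul x := by
    change op (((1 : ℂ)) : ℍ) • x = x
    rw [Quaternion.coeComplex_one, op_one, one_smul]
  mul_smul z w x := by
    change op ((z * w : ℂ) : ℍ) • x = op (z : ℍ) • op (w : ℍ) • x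
    rw [mul_comm, Quaternion.coeComplex_mul, op_mul, mul_smul]
  smul_zero z := smul_zero (op (z : ℍ))
  smul_add z := smul_add (op (z : ℍ))
  add_smul z w x := by
    change op ((z + w : ℂ) : ℍ) • x = op (z : ℍ) • x + op (w : ℍ) • x
    rw [Quaternion.coeComplex_add, op_add, add_smul]
  zero_smul x := by
    change op ((0 : ℂ) : ℍ) • x = 0
    rw [Quaternion.coeComplex_zero, op_zero, zero_smul]
  norm_smul_le z x := by
    change ‖op (z : ℍ) • x‖ ≤ _
    rw [QuatBimodule.norm_smul_right, norm_coeComplex]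

variable [NormedSpace ℝ X]

theorem op_coe_smul (hcompat : ∀ (r : ℝ) (x : X), r • x = ((r : ℝ) : ℍ) • x) (r : ℝ) (x : X) :
    op ((r : ℝ) : ℍ) • x = r • x := by
  rw [hcompat, QuatBimodule.real_smul_comm]

theorem op_real_smul_smul (hcompat : ∀ (r : ℝ) (x : X), r • x = ((r : ℝ) : ℍ) • x) (r : ℝ)
    (q : ℍ) (x : X) : op (r • q) • x = r • op q • x := by
  rw [← Quaternion.mul_coe_eq_smul, op_mul, mul_smul, op_coe_smul hcompat]

/-- The real-linear map `q ↦ x q`. -/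
def rightMulCLM (hcompat : ∀ (r : ℝ) (x : X), r • x = ((r : ℝ) : ℍ) • x) (x : X) : ℍ →L[ℝ] X :=
  LinearMap.mkContinuous
    { toFun := fun q => op q • x
      map_add' := fun p q => by rw [op_add, add_smul]
      map_smul' := fun r q => op_real_smul_smul hcompat r q x } ‖x‖
    fun q => by
      change ‖op q • x‖ ≤ _
      rw [QuatBimodule.norm_smul_right, mul_comm]

theorem rightMulCLM_apply (hcompat : ∀ (r : ℝ) (x : X), r • x = ((r : ℝ) : ℍ) • x) (x : X)
    (q : ℍ) : rightMulCLM hcompat x q = op q • x := rfl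

theorem norm_rightMulCLM_le (hcompat : ∀ (r : ℝ) (x : X), r • x = ((r : ℝ) : ℍ) • x) (x : X) :
    ‖rightMulCLM hcompat x‖ ≤ ‖x‖ :=
  LinearMap.mkContinuous_norm_le _ (norm_nonneg x) _

/-- The multilinear map `(q₁, …, qₙ) ↦ q₁ ⋯ qₖ q̄ₖ₊₁ ⋯ q̄ₙ`. -/
def conjTailProd (n k : ℕ) : ContinuousMultilinearMap ℝ (fun _ : Fin n => ℍ) ℍ :=
  (ContinuousMultilinearMap.mkPiAlgebraFin ℝ n ℍ).compContinuousLinearMap fun i =>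
    if (i : ℕ) < k then ContinuousLinearMap.id ℝ ℍ
    else quatConjCLM

theorem conjTailProd_apply_const {n k : ℕ} (hk : k ≤ n) (q : ℍ) :
    (conjTailProd n k fun _ => q) = q ^ k * star q ^ (n - k) := by
  have h : (List.ofFn fun i : Fin n => if (i : ℕ) < k then q else star q) =
      List.replicate k q ++ List.replicate (n - k) (star q) := by
    refine List.ext_getElem (by simp [hk]) fun i h₁ h₂ => ?_
    simp [List.getElem_append]
  rw [← List.prod_replicate, ← List.prod_replicate, ← List.prod_append, ← h]
  simp only [conjTailProd, ContinuousMultilinearMap.compContinuousLinearMap_apply,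
    ContinuousMultilinearMap.mkPiAlgebraFin_apply]
  congr 2
  ext1 i
  split_ifs
  · rfl
  · rfl

theorem norm_conjTailProd_le (n k : ℕ) : ‖conjTailProd n k‖ ≤ 1 := by
  refine (ContinuousMultilinearMap.norm_compContinuousLinearMap_le _ _).trans ?_
  rw [ContinuousMultilinearMap.norm_mkPiAlgebraFin, one_mul]
  refine Finset.prod_le_one (fun _ _ => norm_nonneg _) fun i _ => ?_
  split_ifs
  · exact ContinuousLinearMap.norm_id_le
  · refine LinearMap.mkContinuous_norm_le _ zero_le_one _

/-- The power series `∑ aₙ₊₁ (qⁿ⁺¹ - q̄ⁿ⁺¹) / (q - q̄)` in the quaternionic variable `q`. -/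
def sphericalSeries (hcompat : ∀ (r : ℝ) (x : X), r • x = ((r : ℝ) : ℍ) • x) (a : ℕ → X) :
    FormalMultilinearSeries ℝ ℍ X := fun n =>
  ∑ k ∈ Finset.range (n + 1),
    (rightMulCLM hcompat (a (n + 1))).compContinuousMultilinearMap (conjTailProd n k)

theorem sphericalSeries_apply_const
    (hcompat : ∀ (r : ℝ) (x : X), r • x = ((r : ℝ) : ℍ) • x) (a : ℕ → X) (n : ℕ) (q : ℍ) :
    (sphericalSeries hcompat a n fun _ => q) = op (sphericalPower n q) • a (n + 1) := by
  rw [← rightMulCLM_apply hcompat, sphericalPower, map_sum, sphericalSeries,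
    sum_apply]
  refine Finset.sum_congr rfl fun k hk => ?_
  rw [← conjTailProd_apply_const (Finset.mem_range_succ_iff.1 hk)]
  rfl

theorem norm_sphericalSeries_le
    (hcompat : ∀ (r : ℝ) (x : X), r • x = ((r : ℝ) : ℍ) • x) (a : ℕ → X) (n : ℕ) :
    ‖sphericalSeries hcompat a n‖ ≤ (n + 1) * ‖a (n + 1)‖ := by
  rw [sphericalSeries]
  refine (norm_sum_le (Finset.range (n + 1)) fun k =>
    (rightMulCLM hcompat (a (n + 1))).compContinuousMultilinearMap (conjTailProd n k)).trans ?_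
  refine (Finset.sum_le_card_nsmul _ _ ‖a (n + 1)‖ fun k _ => ?_).trans ?_
  · refine (ContinuousLinearMap.norm_compContinuousMultilinearMap_le _ _).trans ?_
    exact (mul_le_of_le_one_right (norm_nonneg _) (norm_conjTailProd_le n k)).trans
      (norm_rightMulCLM_le hcompat _)
  · simp

theorem le_radius_sphericalSeries
    (hcompat : ∀ (r : ℝ) (x : X), r • x = ((r : ℝ) : ℍ) • x) {a : ℕ → X} {ρ : NNReal} {C : ℝ}
    (hρ : 0 < ρ) (ha : ∀ n, ‖a n‖ * (ρ : ℝ) ^ n ≤ C) :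
    ((ρ / 2 : NNReal) : ENNReal) ≤ (sphericalSeries hcompat a).radius := by
  have hρ' : (0 : ℝ) < ρ := hρ
  refine FormalMultilinearSeries.le_radius_of_bound _ (C / ρ) fun n => ?_
  have h2 : ((n : ℝ) + 1) ≤ 2 ^ n := by exact_mod_cast Nat.lt_two_pow_self
  push_cast
  calc ‖sphericalSeries hcompat a n‖ * ((ρ : ℝ) / 2) ^ n
      ≤ ((2 ^ n) * ‖a (n + 1)‖) * ((ρ : ℝ) / 2) ^ n := by
        gcongr
        exact (norm_sphericalSeries_le hcompat a n).trans (by gcongr)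
    _ = ‖a (n + 1)‖ * (ρ : ℝ) ^ (n + 1) / ρ := by
        rw [div_pow]
        field_simp
        ring
    _ ≤ C / ρ := by
        gcongr
        exact ha _

end BimoduleStructure

section SphericalDerivative

theorem stem_odd_part_ofReal {E : Type*} [NormedAddCommGroup E] [NormedSpace ℝ E] {D : Set ℂ}
    {F₂ : ℂ → E} (hodd : ∀ z ∈ D, F₂ ((starRingEnd ℂ) z) = -F₂ z) {t : ℝ}
    (ht : (t : ℂ) ∈ D) : F₂ t = 0 := by
  have h := hodd t ht
  rw [Complex.conj_ofReal] at h
  have h2 : (2 : ℝ) • F₂ t = 0 := by rw [two_smul, eq_neg_iff_add_eq_zero.1 h]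
  exact (smul_eq_zero_iff_right two_ne_zero).1 h2

theorem tendsto_stem_odd_part_slope {E : Type*} [NormedAddCommGroup E] [NormedSpace ℝ E] {D : Set ℂ}
    {F₂ : ℂ → E} (hodd : ∀ z ∈ D, F₂ ((starRingEnd ℂ) z) = -F₂ z) {t : ℝ}
    (ht : (t : ℂ) ∈ D) (hd : DifferentiableAt ℝ F₂ t) :
    Tendsto (fun s : ℝ => s⁻¹ • F₂ ⟨t, s⟩) (𝓝[>] 0) (𝓝 (fderiv ℝ F₂ t Complex.I)) := by
  have hl : HasDerivAt (fun s : ℝ => (t : ℂ) + s • Complex.I) Complex.I 0 := by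
    simpa using ((hasDerivAt_id (0 : ℝ)).smul_const Complex.I).const_add (t : ℂ)
  have h0 : (t : ℂ) + (0 : ℝ) • Complex.I = t := by simp
  have hd' : HasFDerivAt F₂ (fderiv ℝ F₂ t) ((t : ℂ) + (0 : ℝ) • Complex.I) := by
    rw [h0]
    exact hd.hasFDerivAt
  have h := (hd'.comp_hasDerivAt (0 : ℝ) hl).tendsto_slope_zero_right
  simp only [Function.comp_apply, h0, stem_odd_part_ofReal hodd ht, sub_zero, zero_add] at h
  refine h.congr fun s => ?_
  congr 2
  apply Complex.ext <;> simp

theorem sderivX_of_im_eq_zero {X : Type*} [NormedAddCommGroup X] [Module ℍ X] [Module ℍᵐᵒᵖ X]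
    [NormedSpace ℝ X] {D : Set ℂ} {F₁ F₂ : ℂ → X} {f : ℍ → X} (hopen : IsOpen D)
    (hodd : ∀ z ∈ D, F₂ ((starRingEnd ℂ) z) = -F₂ z) (h₁ : ContDiffOn ℝ 1 F₁ D)
    (hf : ∀ r s : ℝ, (⟨r, s⟩ : ℂ) ∈ D → ∀ j ∈ Sph,
      f (((r : ℝ) : ℍ) + s • j) = F₁ ⟨r, s⟩ + op j • F₂ ⟨r, s⟩)
    (hCR : ∀ z ∈ D, fderiv ℝ F₁ z 1 = fderiv ℝ F₂ z Complex.I ∧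
      fderiv ℝ F₁ z Complex.I = -fderiv ℝ F₂ z 1)
    {q : ℍ} (hq : (q.re : ℂ) ∈ D) (him : q.im = 0) :
    sderivX f q = fderiv ℝ F₂ q.re Complex.I := by
  rw [sderivX, if_pos him, ← (hCR _ hq).1]
  have d₁ : DifferentiableAt ℝ F₁ (q.re : ℂ) :=
    (h₁.differentiableOn one_ne_zero).differentiableAt (hopen.mem_nhds hq)
  have hd : HasDerivAt (fun t : ℝ => F₁ t) (fderiv ℝ F₁ q.re 1) q.re :=
    d₁.hasFDerivAt.comp_hasDerivAt q.re Complex.ofRealCLM.hasDerivAt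
  refine (hd.congr_of_eventuallyEq ?_).deriv
  filter_upwards [(hopen.preimage Complex.continuous_ofReal).mem_nhds hq] with t ht
  have h := hf t 0 ht _ Sph.I_mem
  rw [zero_smul, add_zero] at h
  rw [h]
  change F₁ t + _ • F₂ t = F₁ t
  rw [stem_odd_part_ofReal hodd ht, smul_zero, add_zero]

variable {X : Type*} [NormedAddCommGroup X] [Module ℍ X] [Module ℍᵐᵒᵖ X] [QuatBimodule X]
  [NormedSpace ℝ X] {D : Set ℂ} {F₁ F₂ : ℂ → X} {f : ℍ → X}

theorem stem_odd_part_regular [CompleteSpace X]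
    (hcompat : ∀ (r : ℝ) (x : X), r • x = ((r : ℝ) : ℍ) • x)
    (hopen : IsOpen D) (hconj : ∀ z ∈ D, (starRingEnd ℂ) z ∈ D)
    (hev : ∀ z ∈ D, F₁ ((starRingEnd ℂ) z) = F₁ z)
    (hodd : ∀ z ∈ D, F₂ ((starRingEnd ℂ) z) = -F₂ z)
    (h₁ : ContDiffOn ℝ 1 F₁ D) (h₂ : ContDiffOn ℝ 1 F₂ D)
    (hCR : ∀ z ∈ D, fderiv ℝ F₁ z 1 = fderiv ℝ F₂ z Complex.I ∧
      fderiv ℝ F₁ z Complex.I = -fderiv ℝ F₂ z 1) :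
    (∀ z ∈ D, AnalyticAt ℝ F₂ z) ∧ ∀ t : ℝ, (t : ℂ) ∈ D →
      ∃ (a : ℕ → X) (ρ : ℝ) (C : ℝ), 0 < ρ ∧ (∀ n, ‖a n‖ * ρ ^ n ≤ C) ∧
        ∀ z : ℂ, ‖z - t‖ < ρ → HasSum (fun n => ((z - t) ^ n).im • a n) (F₂ z) := by
  let _ : NormedSpace ℂ X := rightComplexSpace X
  have _ : IsScalarTower ℝ ℂ X := ⟨fun r z x => by
    change op ((r • z : ℂ) : ℍ) • x = r • op (z : ℍ) • x
    rw [← op_real_smul_smul hcompat]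
    congr 2
    ext <;> simp⟩
  have hd := differentiableOn_stem hopen h₁ h₂ hCR
  exact ⟨fun z hz => analyticAt_stem_odd_part hopen hconj hev hodd hd hz,
    fun t ht => hasSum_stem_odd_part hopen hev hodd hd ht⟩

theorem sderivX_of_im_ne_zero (hcompat : ∀ (r : ℝ) (x : X), r • x = ((r : ℝ) : ℍ) • x)
    (hf : ∀ r s : ℝ, (⟨r, s⟩ : ℂ) ∈ D → ∀ j ∈ Sph,
      f (((r : ℝ) : ℍ) + s • j) = F₁ ⟨r, s⟩ + op j • F₂ ⟨r, s⟩)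
    {q : ℍ} (hq : (⟨q.re, ‖q.im‖⟩ : ℂ) ∈ D) (him : q.im ≠ 0) :
    sderivX f q = ‖q.im‖⁻¹ • F₂ ⟨q.re, ‖q.im‖⟩ := by
  obtain ⟨j, hj, hqj⟩ := exists_eq_re_add_norm_im_smul q
  have hs : ‖q.im‖ ≠ 0 := norm_ne_zero_iff.2 him
  rw [sderivX, if_neg him]
  generalize ‖q.im‖ = s at *
  generalize q.re = r at *
  have hj0 : j ≠ 0 := norm_ne_zero_iff.1 (by rw [(Sph.re_eq_zero hj).2]; exact one_ne_zero)
  have hjs : star j = -j := Quaternion.star_eq_neg.2 (Sph.re_eq_zero hj).1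
  have hj' : -j ∈ Sph := by
    change -j * -j = -1
    rw [neg_mul_neg]
    exact hj
  have hstar : star q = ((r : ℝ) : ℍ) + s • (-j) := by
    rw [hqj, star_add, Quaternion.star_coe, Quaternion.star_smul, hjs]
  have hsub : q - star q = ((2 * s : ℝ) : ℍ) * j := by
    rw [hstar, hqj, Quaternion.coe_mul_eq_smul, two_mul, add_smul, smul_neg]
    abel
  have hfq : f q - f (star q) = op ((2 : ℝ) • j) • F₂ ⟨r, s⟩ := by
    rw [hstar, hqj, hf r s hq j hj, hf r s hq _ hj', two_smul, op_add, add_smul, op_neg, neg_smul]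
    abel
  rw [hfq, hsub, smul_smul, ← op_mul, ← op_coe_smul hcompat]
  congr 2
  rw [mul_inv_rev, ← Quaternion.coe_mul_eq_smul, mul_assoc, ← mul_assoc j,
    mul_inv_cancel₀ hj0, one_mul, ← Quaternion.coe_inv, ← Quaternion.coe_mul]
  congr 1
  field_simp

theorem hasSum_sphericalSeries (hcompat : ∀ (r : ℝ) (x : X), r • x = ((r : ℝ) : ℍ) • x)
    {a : ℕ → X} {b : X} {q : ℍ} (him : q.im ≠ 0)
    (ha : HasSum (fun n => ((⟨q.re, ‖q.im‖⟩ : ℂ) ^ n).im • a n) b) :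
    HasSum (fun n => sphericalSeries hcompat a n fun _ => q) (‖q.im‖⁻¹ • b) := by
  obtain ⟨j, hj, hqj⟩ := exists_eq_re_add_norm_im_smul q
  have h := ((hasSum_nat_add_iff' 1).2 ha).const_smul ‖q.im‖⁻¹
  simp only [Finset.sum_range_one, pow_zero, Complex.one_im, zero_smul, sub_zero] at h
  refine h.congr_fun fun n => ?_
  have hq : sphericalPower n q =
      (((((⟨q.re, ‖q.im‖⟩ : ℂ) ^ (n + 1)).im / ‖q.im‖ : ℝ)) : ℍ) := by
    have := sphericalPower_sliceHom n ⟨j, hj⟩ (w := ⟨q.re, ‖q.im‖⟩) (norm_ne_zero_iff.2 him)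
    rwa [sliceHom_apply, ← hqj] at this
  rw [sphericalSeries_apply_const, hq, op_coe_smul hcompat, smul_smul, div_eq_inv_mul]

theorem analyticAt_sderivX_of_im_ne_zero
    (hcompat : ∀ (r : ℝ) (x : X), r • x = ((r : ℝ) : ℍ) • x)
    (hopen : IsOpen D) (hF₂ : ∀ z ∈ D, AnalyticAt ℝ F₂ z)
    (hf : ∀ r s : ℝ, (⟨r, s⟩ : ℂ) ∈ D → ∀ j ∈ Sph,
      f (((r : ℝ) : ℍ) + s • j) = F₁ ⟨r, s⟩ + op j • F₂ ⟨r, s⟩)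
    {q : ℍ} (hq : (⟨q.re, ‖q.im‖⟩ : ℂ) ∈ D) (him : q.im ≠ 0) :
    AnalyticAt ℝ (sderivX f) q := by
  let reL : ℍ →L[ℝ] ℝ := ⟨⟨⟨fun p => p.re, fun _ _ => rfl⟩, fun _ _ => rfl⟩,
    Quaternion.continuous_re⟩
  let imL : ℍ →L[ℝ] ℍ := ⟨⟨⟨fun p => p.im, fun _ _ => by ext <;> simp⟩,
    fun _ _ => by ext <;> simp⟩, Quaternion.continuous_im⟩
  have hn : AnalyticAt ℝ (fun p : ℍ => ‖p.im‖) q :=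
    ((contDiffAt_norm ℝ him).comp q imL.contDiff.contDiffAt).analyticAt
  have hz : AnalyticAt ℝ (fun p : ℍ => (⟨p.re, ‖p.im‖⟩ : ℂ)) q :=
    AnalyticAt.comp (f := fun p : ℍ => (p.re, ‖p.im‖))
      (Complex.equivRealProdCLM.symm.toContinuousLinearMap.analyticAt (q.re, ‖q.im‖))
      ((reL.analyticAt q).prod hn)
  have hFz : AnalyticAt ℝ (fun p : ℍ => F₂ ⟨p.re, ‖p.im‖⟩) q :=
    AnalyticAt.comp (hF₂ _ hq) hz
  refine ((hn.inv (norm_ne_zero_iff.2 him)).smul hFz).congr ?_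
  filter_upwards [(hopen.preimage continuous_re_norm_im).mem_nhds hq,
    (isOpen_ne.preimage Quaternion.continuous_im).mem_nhds him] with p hp hp'
  exact (sderivX_of_im_ne_zero hcompat hf hp hp').symm

theorem analyticAt_sderivX_of_im_eq_zero [CompleteSpace X]
    (hcompat : ∀ (r : ℝ) (x : X), r • x = ((r : ℝ) : ℍ) • x) (hopen : IsOpen D)
    (hodd : ∀ z ∈ D, F₂ ((starRingEnd ℂ) z) = -F₂ z)
    (h₁ : ContDiffOn ℝ 1 F₁ D) (h₂ : ContDiffOn ℝ 1 F₂ D)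
    (hf : ∀ r s : ℝ, (⟨r, s⟩ : ℂ) ∈ D → ∀ j ∈ Sph,
      f (((r : ℝ) : ℍ) + s • j) = F₁ ⟨r, s⟩ + op j • F₂ ⟨r, s⟩)
    (hCR : ∀ z ∈ D, fderiv ℝ F₁ z 1 = fderiv ℝ F₂ z Complex.I ∧
      fderiv ℝ F₁ z Complex.I = -fderiv ℝ F₂ z 1)
    {t : ℝ} (ht : (t : ℂ) ∈ D) {a : ℕ → X} {ρ C : ℝ} (hρ : 0 < ρ)
    (ha : ∀ n, ‖a n‖ * ρ ^ n ≤ C)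
    (hsum : ∀ z : ℂ, ‖z - t‖ < ρ → HasSum (fun n => ((z - t) ^ n).im • a n) (F₂ z)) :
    AnalyticAt ℝ (sderivX f) (t : ℍ) := by
  lift ρ to NNReal using hρ.le
  set p := sphericalSeries hcompat a
  have hrad : 0 < p.radius :=
    lt_of_lt_of_le (by exact_mod_cast half_pos hρ) (le_radius_sphericalSeries hcompat hρ ha)
  have hball := p.hasFPowerSeriesOnBall hrad
  set P : ℍ → X := fun q => p.sum (q - (t : ℍ))
  set V : Set ℍ := ((fun q : ℍ => (⟨q.re, ‖q.im‖⟩ : ℂ)) ⁻¹' (D ∩ Metric.ball (t : ℂ) ρ)) ∩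
    ((fun q : ℍ => q - (t : ℍ)) ⁻¹' Metric.eball 0 p.radius)
  have hVo : IsOpen V :=
    ((hopen.inter Metric.isOpen_ball).preimage continuous_re_norm_im).inter
      (Metric.isOpen_eball.preimage (continuous_id.sub continuous_const))
  have hPan : ∀ q ∈ V, AnalyticAt ℝ P q := fun q hq =>
    AnalyticAt.comp (f := fun q : ℍ => q - (t : ℍ)) (hball.analyticOnNhd _ hq.2) (analyticAt_id.sub analyticAt_const)
  have hoff : ∀ q ∈ V, q.im ≠ 0 → sderivX f q = P q := by
    intro q hq him
    have him' : (q - (t : ℍ)).im = q.im := by simp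
    have hz : (⟨q.re, ‖q.im‖⟩ : ℂ) - t = ⟨(q - (t : ℍ)).re, ‖(q - (t : ℍ)).im‖⟩ := by
      rw [him']
      apply Complex.ext <;> simp
    have h := hsum _ (mem_ball_iff_norm.1 hq.1.2)
    rw [hz] at h
    rw [sderivX_of_im_ne_zero hcompat hf hq.1.1 him, ← him']
    exact (hasSum_sphericalSeries hcompat (him'.symm ▸ him)
      (by rw [him']; rwa [him'] at h)).tsum_eq.symm
  have hon : ∀ q ∈ V, q.im = 0 → sderivX f q = P q := by
    intro q hq him
    have hqD : (q.re : ℂ) ∈ D := by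
      have : (⟨q.re, ‖q.im‖⟩ : ℂ) ∈ D := hq.1.1
      rwa [him, norm_zero] at this
    rw [sderivX_of_im_eq_zero hopen hodd h₁ hf hCR hqD him]
    have hd : DifferentiableAt ℝ F₂ (q.re : ℂ) :=
      (h₂.differentiableOn one_ne_zero).differentiableAt (hopen.mem_nhds hqD)
    refine tendsto_nhds_unique (tendsto_stem_odd_part_slope hodd hqD hd) ?_
    have hcurve : Continuous fun s : ℝ => q + s • ((Complex.I : ℂ) : ℍ) := by fun_prop
    have hlim : Tendsto (fun s : ℝ => q + s • ((Complex.I : ℂ) : ℍ)) (𝓝[>] 0) (𝓝 q) := by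
      have := hcurve.tendsto 0
      rw [zero_smul, add_zero] at this
      exact this.mono_left nhdsWithin_le_nhds
    refine ((hPan q hq).continuousAt.tendsto.comp hlim).congr' ?_
    filter_upwards [hlim (hVo.mem_nhds hq), self_mem_nhdsWithin] with s hs hs0
    have hs0' : 0 < s := hs0
    have hre : (q + s • ((Complex.I : ℂ) : ℍ)).re = q.re := by simp
    have him' : (q + s • ((Complex.I : ℂ) : ℍ)).im = s • ((Complex.I : ℂ) : ℍ) := by
      rw [Quaternion.im_add, him, zero_add]
      ext <;> simp
    have hnorm : ‖(q + s • ((Complex.I : ℂ) : ℍ)).im‖ = s := by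
      rw [him', norm_smul, norm_coeComplex, Complex.norm_I, mul_one, Real.norm_of_nonneg hs0'.le]
    have hne : (q + s • ((Complex.I : ℂ) : ℍ)).im ≠ 0 := by
      rw [← norm_ne_zero_iff, hnorm]
      exact hs0'.ne'
    change P (q + s • ((Complex.I : ℂ) : ℍ)) = _
    rw [← hoff _ hs hne, sderivX_of_im_ne_zero hcompat hf hs.1.1 hne, hnorm, hre]
  have htV : (t : ℍ) ∈ V := by
    refine ⟨?_, by simpa using hrad⟩
    have : (⟨(t : ℍ).re, ‖(t : ℍ).im‖⟩ : ℂ) = t := by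
      apply Complex.ext <;> simp
    rw [Set.mem_preimage, this]
    exact ⟨ht, Metric.mem_ball_self hρ⟩
  refine (hPan _ htV).congr ?_
  filter_upwards [hVo.mem_nhds htV] with q hq
  by_cases him : q.im = 0
  · exact (hon q hq him).symm
  · exact (hoff q hq him).symm

end SphericalDerivative

/-- Proposition `prop:sd`: if `D ⊆ ℂ` is a nonempty open set
invariant under complex conjugation and `f : Ω_D → X` is right slice regular,
then its spherical derivative `∂_S f : Ω_D → X` is real analytic (`Ω_D` regarded
as an open subset of `ℝ⁴` and `X` as a real Banach space). -/
theorem stmt15 {X : Type*} [NormedAddCommGroup X] [CompleteSpace X]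
    [Module ℍ X] [Module ℍᵐᵒᵖ X] [QuatBimodule X] [NormedSpace ℝ X]
    (hcompat : ∀ (r : ℝ) (x : X), r • x = ((r : ℝ) : ℍ) • x)
    (D : Set ℂ) (hne : D.Nonempty) (hopen : IsOpen D)
    (hconj : ∀ z ∈ D, (starRingEnd ℂ) z ∈ D)
    (f : ℍ → X) (hf : RightSliceRegular D f) :
    RealAnalyticOnH (sderivX f) (circ D) := by
  obtain ⟨F₁, F₂, hev, hodd, h₁, h₂, hstem, hCR⟩ := hf
  obtain ⟨hF₂, hseries⟩ := stem_odd_part_regular hcompat hopen hconj hev hodd h₁ h₂ hCR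
  refine realAnalyticOnH_of_analyticAt (isOpen_circ hopen hconj) fun q hq => ?_
  rw [mem_circ_iff hconj] at hq
  by_cases him : q.im = 0
  · rw [him, norm_zero] at hq
    obtain ⟨a, ρ, C, hρ, ha, hsum⟩ := hseries q.re hq
    have hre : q = (q.re : ℍ) := by
      conv_lhs => rw [← Quaternion.re_add_im q, him, add_zero]
    rw [hre]
    exact analyticAt_sderivX_of_im_eq_zero hcompat hopen hodd h₁ h₂ hstem hCR hq hρ ha hsum
  · exact analyticAt_sderivX_of_im_ne_zero hcompat hopen hF₂ hstem hq him
end
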